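/- Let k be a field of characteristic p > 0, R = k[x_0,...,x_n], and I ⊆ R an ideal generated by d-forms. Let c = fpt(I) and h = height of the test ideal τ(R, I^c). If the pair (R, I^c) is sharply F-pure, then c ≥ h/d. -/

import Mathlib

open MvPolynomial Filter

noncomputable section

variable {k : Type*} [Field k]

/-- The `q`-th bracket power of an ideal. -/
def frobPow {R : Type*} [CommRing R] (q : ℕ) (I : Ideal R) : Ideal R :=
  Ideal.span ((fun x => x ^ q) '' (I : Set R))

/-- The homogeneous maximal ideal of `k[x_0,…,x_n]`. -/
def maxIdl (n : ℕ) (k : Type*) [Field k] : Ideal (MvPolynomial (Fin (n + 1)) k) :=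
  Ideal.span (Set.range X)

/-- `ν_I(q) = max{r : I^r ⊄ 𝔪^{[q]}}`. -/
def nuFn {n : ℕ} (I : Ideal (MvPolynomial (Fin (n + 1)) k)) (q : ℕ) : ℕ :=
  sSup {r : ℕ | ¬ I ^ r ≤ frobPow q (maxIdl n k)}

/-- The height of an ideal. -/
def idealHeight {R : Type*} [CommRing R] (I : Ideal R) : ℕ∞ :=
  ⨅ (p : PrimeSpectrum R) (_ : I ≤ p.asIdeal), Order.height p

/-- The `q`-th Frobenius root `J^{[1/q]}`: the smallest ideal whose `q`-th bracket power
contains `J`. -/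
def frobRoot {R : Type*} [CommRing R] (q : ℕ) (J : Ideal R) : Ideal R :=
  sInf {K : Ideal R | J ≤ frobPow q K}

/-- The test ideal `τ(R, I^c)` of a pair over a polynomial ring, via the
Blickle–Mustață–Smith description `τ(I^c) = ⋃_e (I^{⌈c p^e⌉})^{[1/p^e]}`. -/
def testIdeal {R : Type*} [CommRing R] (p : ℕ) (c : ℝ) (I : Ideal R) : Ideal R :=
  ⨆ e : ℕ, frobRoot (p ^ e) (I ^ ⌈c * (p : ℝ) ^ e⌉₊)

/-- The pair `(R, I^t)` is sharply `F`-pure: for infinitely many `e > 0` the evaluation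
map `I^{⌈t(p^e−1)⌉}·Hom(F^e_*R, R) → R` is surjective. -/
def SharplyFPurePair {R : Type*} [CommRing R] (p : ℕ) (I : Ideal R) (t : ℝ) : Prop :=
  ∃ᶠ e : ℕ in atTop, 0 < e ∧
    Ideal.span {y : R | ∃ (φ : R →+ R) (a : R),
      (∀ r x : R, φ (r ^ p ^ e * x) = r * φ x) ∧
      a ∈ I ^ ⌈t * ((p : ℝ) ^ e - 1)⌉₊ ∧ y = φ a} = ⊤


lemma dimLemma {n : ℕ} (T : Finset (Fin (n + 1))) (J : Ideal (MvPolynomial (Fin (n + 1)) k)) (h : ℕ)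
    (hh : ∀ P : Ideal (MvPolynomial (Fin (n + 1)) k), P.IsPrime → J ≤ P → (h : ℕ∞) ≤ P.height)
    (hT : n + 1 < T.card + h) :
    ∃ u ∈ J, u ≠ 0 ∧ ∀ a ∈ u.support, ∀ i ∉ T, a i = 0 := by
  classical
  let S1 := {i : Fin (n + 1) // i ∉ T}
  let S2 := {i : Fin (n + 1) // ¬ i ∉ T}
  let A := MvPolynomial S2 k
  let K := FractionRing A
  let E1 : MvPolynomial (Fin (n + 1)) k ≃+* MvPolynomial (S1 ⊕ S2) k :=
    (renameEquiv k (Equiv.sumCompl (fun i => i ∉ T)).symm).toRingEquiv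
  let E : MvPolynomial (Fin (n + 1)) k ≃+* MvPolynomial S1 A := E1.trans (sumRingEquiv k S1 S2)
  have hE : ∀ a : A, E (rename Subtype.val a) = C a := by
    intro a
    have hE1 : ∀ b : A, E1 (rename Subtype.val b) = rename Sum.inr b := by
      intro b
      change renameEquiv k _ (rename Subtype.val b) = _
      rw [renameEquiv_apply, rename_rename]
      congr 1
      ext i
      simp
    change sumRingEquiv k S1 S2 (E1 _) = _
    rw [hE1]
    induction a using MvPolynomial.induction_on with
    | C a => simp
    | add p q hp hq => simp [hp, hq]
    | mul_X p i hp => simp [hp]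
  let M : Submonoid (MvPolynomial S1 A) := (nonZeroDivisors A).map (C (σ := S1))
  let J' : Ideal (MvPolynomial S1 A) := J.comap E.symm
  by_cases hdis : Disjoint (J' : Set (MvPolynomial S1 A)) M
  · exfalso
    obtain ⟨P', hP', hJP, hd⟩ := Ideal.exists_le_prime_disjoint J' M hdis
    let _ : Algebra (MvPolynomial S1 A) (MvPolynomial S1 K) := algebraMvPolynomial
    have : IsLocalization M (MvPolynomial S1 K) := MvPolynomial.isLocalization (nonZeroDivisors A) K
    have h1 := IsLocalization.height_map_of_disjoint (S := MvPolynomial S1 K) M P' hd.symm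
    have hpr := IsLocalization.isPrime_of_isPrime_disjoint M (MvPolynomial S1 K) P' hP' hd.symm
    have h2 := Ideal.height_le_ringKrullDim_of_isPrime
      (I := P'.map (algebraMap (MvPolynomial S1 A) (MvPolynomial S1 K)))
    have h3 : ringKrullDim (MvPolynomial S1 K) = ringKrullDim K + Nat.card S1 :=
      MvPolynomial.ringKrullDim_of_isNoetherianRing
    rw [h1, h3, ringKrullDim_eq_zero_of_field] at h2
    have h4 := E.height_comap P'
    have h5 := hh (P'.comap E) (Ideal.comap_isPrime _ _) (by
      intro x hx
      rw [Ideal.mem_comap]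
      apply hJP
      change E.symm (E x) ∈ J
      simpa using hx)
    rw [h4] at h5
    have h6 : ((h : ℕ∞) : WithBot ℕ∞) ≤ 0 + (Nat.card S1 : WithBot ℕ∞) :=
      le_trans (WithBot.coe_le_coe.mpr h5) h2
    rw [zero_add] at h6
    have h7 : h ≤ Nat.card S1 := by exact_mod_cast h6
    have h8 : Nat.card S1 = n + 1 - T.card := by
      rw [Nat.card_eq_fintype_card, Fintype.card_subtype_compl]
      simp
    have h9 : T.card ≤ n + 1 := by simpa using T.card_le_univ
    omega
  · rw [Set.not_disjoint_iff] at hdis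
    obtain ⟨x, hx, a, ha, rfl⟩ := hdis
    have ha0 : a ≠ 0 := nonZeroDivisors.ne_zero ha
    refine ⟨rename Subtype.val a, ?_, ?_, ?_⟩
    · have : E.symm (C a) ∈ J := hx
      rwa [← hE a, RingEquiv.symm_apply_apply] at this
    · intro h0
      exact ha0 (rename_injective _ Subtype.val_injective (by simpa using h0))
    · intro b hb i hi
      by_contra hne
      have : i ∈ (rename Subtype.val a).vars := by
        rw [mem_vars_iff_mem_support]; exact ⟨b, hb, by simpa using hne⟩
      have := vars_rename _ _ this
      simp at this
      exact hi this.1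

lemma frobPow_eq_map {R : Type*} [CommRing R] {p : ℕ} [Fact p.Prime] [CharP R p] (e : ℕ)
    (I : Ideal R) : frobPow (p ^ e) I = I.map (iterateFrobenius R p e) := by
  rfl

lemma frobPow_max {n p : ℕ} [Fact p.Prime] [CharP k p] (e : ℕ) :
    frobPow (p ^ e) (maxIdl n k) =
      Ideal.span (Set.range fun i => (X i : MvPolynomial (Fin (n + 1)) k) ^ p ^ e) := by
  rw [frobPow_eq_map, maxIdl, Ideal.map_span, ← Set.range_comp]
  rfl

lemma mem_frobPow_max {n p : ℕ} [Fact p.Prime] [CharP k p] (e : ℕ)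
    (f : MvPolynomial (Fin (n + 1)) k) :
    f ∈ frobPow (p ^ e) (maxIdl n k) ↔ ∀ a ∈ f.support, ∃ i, p ^ e ≤ a i := by
  have : (Set.range fun i => (X i : MvPolynomial (Fin (n + 1)) k) ^ p ^ e) =
      (fun s => monomial s (1 : k)) '' Set.range (fun i => Finsupp.single i (p ^ e)) := by
    rw [← Set.range_comp]
    congr 1
    ext i : 1
    simp [X_pow_eq_monomial]
  rw [frobPow_max, this, mem_ideal_span_monomial_image]
  simp

lemma combLemma {n p : ℕ} [Fact p.Prime] [CharP k p] (J : Ideal (MvPolynomial (Fin (n + 1)) k))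
    (h : ℕ)
    (H : ∀ T : Finset (Fin (n + 1)), n + 1 < T.card + h →
      ∃ u ∈ J, u ≠ 0 ∧ ∀ a ∈ u.support, ∀ i ∉ T, a i = 0) :
    ∃ C : ℕ, ∀ e : ℕ, ∀ g : Fin (n + 1) →₀ ℕ,
      (n + 1) * (p ^ e - 1) + C < g.degree + h * (p ^ e - 1) →
      monomial g (1 : k) ∈ J ⊔ frobPow (p ^ e) (maxIdl n k) := by
  classical
  have H2 : ∀ T : Finset (Fin (n + 1)), n + 1 < T.card + h →
      ∃ u ∈ J, ∃ m ∈ u.support, (∀ i ∉ T, m i = 0) ∧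
        ∀ b ∈ u.support, b ≠ m → toDegLex m < toDegLex b := by
    intro T hT
    obtain ⟨u, hu, hu0, hs⟩ := H T hT
    obtain ⟨m, hm, hmin⟩ := Finset.exists_min_image u.support (fun a => toDegLex a)
      (support_nonempty.mpr hu0)
    exact ⟨u, hu, m, hm, hs m hm, fun b hb hne => lt_of_le_of_ne (hmin b hb) (by simpa using hne.symm)⟩
  choose! u huJ m hm hmT hmin using H2
  let C0 : ℕ := Finset.univ.sup (fun T => (m T).degree)
  have hC0 : ∀ T i, m T i ≤ C0 := fun T i =>
    le_trans (Finsupp.le_degree i (m T)) (Finset.le_sup (f := fun T => (m T).degree) (Finset.mem_univ T))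
  refine ⟨(n + 1) * C0, fun e g hg => ?_⟩
  set q := p ^ e with hq
  by_contra hbad
  let Bad : Set (Fin (n + 1) →₀ ℕ) := {g | (n + 1) * (q - 1) + (n + 1) * C0 < g.degree + h * (q - 1) ∧
      monomial g (1 : k) ∉ J ⊔ frobPow q (maxIdl n k)}
  have hlt : ∀ g ∈ Bad, ∀ i, g i < q := by
    intro g hg i
    by_contra hi
    apply hg.2
    apply Ideal.mem_sup_right
    rw [hq, mem_frobPow_max]
    intro a ha
    rw [support_monomial, if_neg one_ne_zero, Finset.mem_singleton] at ha
    subst ha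
    exact ⟨i, not_lt.mp hi⟩
  have hfin : Bad.Finite := by
    apply (Set.finite_Iic (Finsupp.equivFunOnFinite.symm (fun _ : Fin (n+1) => q))).subset
    intro g hg
    rw [Set.mem_Iic]
    intro i
    simpa using (hlt g hg i).le
  obtain ⟨g, hgB, hgmax⟩ := hfin.exists_maximalFor (fun a => toDegLex a) Bad ⟨g, hg, hbad⟩
  have hgmax' : ∀ b, toDegLex g < toDegLex b → b ∉ Bad := by
    intro b hb hbB
    exact absurd (hgmax hbB hb.le) (not_le.mpr hb)
  let T : Finset (Fin (n + 1)) := Finset.univ.filter (fun i => C0 ≤ g i)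
  have hT : n + 1 < T.card + h := by
    by_contra hcon
    have h1 : g.degree ≤ T.card * (q - 1) + (n + 1) * C0 := by
      rw [Finsupp.degree_eq_sum]
      calc ∑ i, g i ≤ ∑ i, ((if i ∈ T then (q - 1) else 0) + C0) := by
            apply Finset.sum_le_sum
            intro i _
            have := hlt g hgB i
            by_cases hi : i ∈ T
            · simp only [hi, if_true]; omega
            · have : ¬ C0 ≤ g i := by simpa [T] using hi
              omega
        _ = T.card * (q - 1) + (n + 1) * C0 := by
            rw [Finset.sum_add_distrib, Finset.sum_ite_mem]
            simp
    have h2 : (T.card + h) * (q - 1) ≤ (n + 1) * (q - 1) := Nat.mul_le_mul_right _ (not_lt.mp hcon)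
    have h3 := hgB.1
    rw [add_mul] at h2
    omega
  have hle : m T ≤ g := by
    intro i
    by_cases hi : i ∈ T
    · exact (hC0 T i).trans (by simpa [T] using hi)
    · simp [hmT T hT i hi]
  apply hgB.2
  have hcoef : coeff (m T) (u T) ≠ 0 := mem_support_iff.mp (hm T hT)
  have key : monomial (g - m T) (1 : k) * u T =
      monomial g (coeff (m T) (u T)) +
      ∑ b ∈ (u T).support.erase (m T), monomial (g - m T + b) (coeff b (u T)) := by
    conv_lhs => rw [(u T).as_sum, Finset.mul_sum]
    rw [← Finset.add_sum_erase _ _ (hm T hT)]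
    simp [monomial_mul, tsub_add_cancel_of_le hle]
  have hmon : ∀ (b) (c : k), monomial b (1 : k) ∈ J ⊔ frobPow q (maxIdl n k) →
      monomial b c ∈ J ⊔ frobPow q (maxIdl n k) := by
    intro b c hb
    have := Ideal.mul_mem_left _ (C c) hb
    rwa [C_mul_monomial, mul_one] at this
  have hsum : ∑ b ∈ (u T).support.erase (m T), monomial (g - m T + b) (coeff b (u T)) ∈
      J ⊔ frobPow q (maxIdl n k) := by
    apply Ideal.sum_mem
    intro b hb
    apply hmon
    rw [Finset.mem_erase] at hb
    have hlt' : toDegLex g < toDegLex (g - m T + b) := by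
      have := hmin T hT b hb.2 hb.1
      have h2 := add_lt_add_right this (toDegLex (g - m T))
      rwa [← toDegLex_add, ← toDegLex_add, tsub_add_cancel_of_le hle] at h2
    have hdeg : g.degree ≤ (g - m T + b).degree := Finsupp.DegLex.monotone_degree hlt'.le
    by_contra hn
    exact hgmax' _ hlt' ⟨by have := hgB.1; omega, hn⟩
  have h1 : monomial (g - m T) (1 : k) * u T ∈ J ⊔ frobPow q (maxIdl n k) :=
    Ideal.mem_sup_left (Ideal.mul_mem_left _ _ (huJ T hT))
  rw [key] at h1
  have h2 := (Ideal.add_mem_iff_left _ hsum).mp h1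
  have := Ideal.mul_mem_left _ (C (coeff (m T) (u T))⁻¹) h2
  rwa [C_mul_monomial, inv_mul_cancel₀ hcoef] at this

/-- Coordinate functions of `k` over its subfield of `p^e`-th powers. -/
lemma exists_coords.{u} (k : Type u) [Field k] {p : ℕ} [Fact p.Prime] [CharP k p] (e : ℕ) :
    ∃ (ι : Type u) (v : ι → k) (s : ι → k →+ k),
      (∀ j a b, s j (a ^ p ^ e * b) = a * s j b) ∧
      ∀ x, ∃ J0 : Finset ι, ∀ J : Finset ι, J0 ⊆ J → x = ∑ j ∈ J, (s j x) ^ p ^ e * v j := by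
  classical
  let F := iterateFrobenius k p e
  let L : Subfield k := F.fieldRange
  let B := Module.Basis.ofVectorSpace L k
  let E : k ≃+* L := RingEquiv.ofBijective F.rangeRestrictField
    ⟨F.rangeRestrictField.injective, fun ⟨_, x, hx⟩ => ⟨x, Subtype.ext hx⟩⟩
  have hE : ∀ a, (E a : k) = a ^ p ^ e := fun a => rfl
  have hE' : ∀ l : L, (E.symm l) ^ p ^ e = (l : k) := by
    intro l
    rw [← hE, RingEquiv.apply_symm_apply]
  refine ⟨_, B, fun j => (E.symm : L →+ k).comp
    ((B.coord j).toAddMonoidHom), ?_, ?_⟩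
  · intro j a b
    have : a ^ p ^ e * b = (E a) • b := by
      rw [Subfield.smul_def, hE, smul_eq_mul]
    rw [this]
    simp
  · intro x
    refine ⟨(B.repr x).support, fun J hJ => ?_⟩
    conv_lhs => rw [← B.linearCombination_repr x, Finsupp.linearCombination_apply]
    rw [Finsupp.sum_of_support_subset _ hJ _ (by simp)]
    apply Finset.sum_congr rfl
    intro j _
    simp [hE', Subfield.smul_def]

lemma exists_phi.{u} {k : Type u} [Field k] {n p : ℕ} [Fact p.Prime] [CharP k p] (e : ℕ) :
    ∃ (ι : Type u) (w : ι → MvPolynomial (Fin (n + 1)) k)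
      (φ : ι → MvPolynomial (Fin (n + 1)) k →+ MvPolynomial (Fin (n + 1)) k),
      (∀ j a b, φ j (a ^ p ^ e * b) = a * φ j b) ∧
      ∀ x, ∃ J0 : Finset ι, ∀ J : Finset ι, J0 ⊆ J → x = ∑ j ∈ J, (φ j x) ^ p ^ e * w j := by
  classical
  obtain ⟨ι, v, s, hs, hx⟩ := exists_coords k (p := p) e
  set q := p ^ e with hq
  have hq0 : 0 < q := pow_pos (Fact.out : p.Prime).pos e
  let dv : (Fin (n + 1) →₀ ℕ) → (Fin (n + 1) →₀ ℕ) := fun a => a.mapRange (· / q) (by simp)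
  let md : (Fin (n + 1) →₀ ℕ) → (Fin (n + 1) →₀ ℕ) := fun a => a.mapRange (· % q) (by simp)
  have hdm : ∀ a, q • dv a + md a = a := by
    intro a; ext i; exact Nat.div_add_mod (a i) q
  have hdv : ∀ a b, dv (q • b + a) = b + dv a := by
    intro a b; ext i; simp [dv, Nat.mul_add_div hq0]
  have hmd : ∀ a b, md (q • b + a) = md a := by
    intro a b; ext i; exact Nat.mul_add_mod q (b i) (a i)
  let φ : ι × (Fin (n + 1) →₀ ℕ) → MvPolynomial (Fin (n + 1)) k →+ MvPolynomial (Fin (n + 1)) k :=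
    fun jr => (Finsupp.liftAddHom (fun a => if md a = jr.2 then
      (monomial (dv a)).toAddMonoidHom.comp (s jr.1) else 0)).comp
      (AddMonoidAlgebra.coeffAddEquiv : MvPolynomial (Fin (n + 1)) k ≃+ _).toAddMonoidHom
  have hφ : ∀ jr a c, φ jr (monomial a c) = if md a = jr.2 then monomial (dv a) (s jr.1 c) else 0 := by
    intro jr a c
    have : φ jr (monomial a c) = Finsupp.liftAddHom (fun a => if md a = jr.2 then
      (monomial (dv a)).toAddMonoidHom.comp (s jr.1) else 0) (Finsupp.single a c) := rfl
    rw [this, Finsupp.liftAddHom_apply_single]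
    split_ifs <;> rfl
  refine ⟨_, fun jr => monomial jr.2 (v jr.1), φ, ?_, ?_⟩
  · intro jr a b
    induction a using MvPolynomial.induction_on' with
    | add a1 a2 h1 h2 =>
      have : (a1 + a2) ^ q = a1 ^ q + a2 ^ q := add_pow_char_pow ..
      rw [this, add_mul, map_add, h1, h2, add_mul]
    | monomial β c =>
      induction b using MvPolynomial.induction_on' with
      | add b1 b2 h1 h2 => rw [mul_add, map_add, h1, h2, map_add, mul_add]
      | monomial α d =>
        rw [monomial_pow, monomial_mul, hφ, hφ, hmd, hdv, hs]
        split_ifs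
        · rw [monomial_mul]
        · simp
  · intro x
    induction x using MvPolynomial.induction_on' with
    | add x y hx hy =>
      obtain ⟨J1, h1⟩ := hx
      obtain ⟨J2, h2⟩ := hy
      refine ⟨J1 ∪ J2, fun J hJ => ?_⟩
      have e1 := h1 J (Finset.union_subset_left hJ)
      have e2 := h2 J (Finset.union_subset_right hJ)
      conv_lhs => rw [e1, e2]
      rw [← Finset.sum_add_distrib]
      apply Finset.sum_congr rfl
      intro j _
      have : (φ j x + φ j y) ^ q = φ j x ^ q + φ j y ^ q := add_pow_char_pow ..
      rw [map_add, this, add_mul]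
    | monomial a c =>
      obtain ⟨J0, hJ0⟩ := hx c
      refine ⟨J0 ×ˢ {md a}, fun J hJ => ?_⟩
      have hterm : ∀ j, (φ (j, md a) (monomial a c)) ^ q * monomial (md a) (v j)
          = monomial a ((s j c) ^ q * v j) := by
        intro j
        rw [hφ, if_pos rfl, monomial_pow, monomial_mul, hdm]
      have hJ1 : ∀ j ∈ J, j.2 = md a ∨
          (φ j (monomial a c)) ^ q * monomial j.2 (v j.1) = 0 := by
        intro j _
        by_cases h : md a = j.2
        · exact Or.inl h.symm
        · right; rw [hφ, if_neg h, zero_pow hq0.ne', zero_mul]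
      have h3 : ∑ j ∈ J, (φ j (monomial a c)) ^ q * monomial j.2 (v j.1) =
          ∑ j ∈ J.filter (fun j => j.2 = md a), (φ j (monomial a c)) ^ q * monomial j.2 (v j.1) := by
        symm
        apply Finset.sum_subset (Finset.filter_subset _ _)
        intro j hj hj'
        rcases hJ1 j hj with h | h
        · exact absurd (Finset.mem_filter.mpr ⟨hj, h⟩) hj'
        · exact h
      have h4 : J.filter (fun j => j.2 = md a) =
          ((J.filter (fun j => j.2 = md a)).image Prod.fst) ×ˢ {md a} := by
        ext ⟨j, r⟩
        simp only [Finset.mem_filter, Finset.mem_product, Finset.mem_image, Finset.mem_singleton]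
        constructor
        · rintro ⟨h1, h2⟩; exact ⟨⟨(j, r), ⟨h1, h2⟩, rfl⟩, h2⟩
        · rintro ⟨⟨⟨j', r'⟩, ⟨h1, h2⟩, h3⟩, h4⟩
          simp only at h2 h3
          subst h2 h3 h4
          exact ⟨h1, rfl⟩
      rw [h3, h4, Finset.sum_product]
      simp only [Finset.sum_singleton, hterm]
      rw [← map_sum, ← hJ0]
      intro j hj
      rw [Finset.mem_image]
      exact ⟨(j, md a), Finset.mem_filter.mpr ⟨hJ (by simpa using hj), rfl⟩, rfl⟩

lemma phi_frobPow {n p : ℕ} [Fact p.Prime] [CharP k p] (e e' : ℕ)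
    (φ : MvPolynomial (Fin (n + 1)) k →+ MvPolynomial (Fin (n + 1)) k)
    (hφ : ∀ a b, φ (a ^ p ^ e * b) = a * φ b) (x : MvPolynomial (Fin (n + 1)) k)
    (hx : x ∈ frobPow (p ^ (e' + e)) (maxIdl n k)) : φ x ∈ frobPow (p ^ e') (maxIdl n k) := by
  have h1 : frobPow (p ^ (e' + e)) (maxIdl n k) = frobPow (p ^ e) (frobPow (p ^ e') (maxIdl n k)) := by
    rw [frobPow_max, frobPow_max, frobPow_eq_map, Ideal.map_span, ← Set.range_comp]
    congr 2
    ext i : 1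
    simp [iterateFrobenius_def, ← pow_mul, pow_add]
  rw [h1, frobPow] at hx
  have key : ∀ a, φ (a * x) ∈ frobPow (p ^ e') (maxIdl n k) := by
    clear h1
    induction hx using Submodule.span_induction with
    | mem y hy =>
      intro a
      obtain ⟨z, hz, rfl⟩ := hy
      rw [mul_comm, hφ]
      exact Ideal.mul_mem_right _ _ hz
    | zero => simp
    | add y z _ _ hy hz => intro a; rw [mul_add, map_add]; exact Ideal.add_mem _ (hy a) (hz a)
    | smul b y _ hy => intro a; rw [smul_eq_mul, ← mul_assoc]; exact hy (a * b)
  simpa using key 1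

lemma colonLemma {n p : ℕ} [Fact p.Prime] [CharP k p] (e e' : ℕ)
    (a b : MvPolynomial (Fin (n + 1)) k)
    (h : a ^ p ^ e * b ∈ frobPow (p ^ (e' + e)) (maxIdl n k))
    (K : Ideal (MvPolynomial (Fin (n + 1)) k))
    (hK : ∀ y, a * y ∈ frobPow (p ^ e') (maxIdl n k) → y ∈ K) : b ∈ frobPow (p ^ e) K := by
  obtain ⟨ι, w, φ, hφ, hx⟩ := exists_phi (k := k) (n := n) (p := p) e
  obtain ⟨J, hJ⟩ := hx b
  rw [hJ J subset_rfl]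
  apply Ideal.sum_mem
  intro j _
  apply Ideal.mul_mem_right
  apply Ideal.subset_span
  refine ⟨_, ?_, rfl⟩
  apply hK
  rw [← hφ j]
  exact phi_frobPow e e' (φ j) (hφ j) _ h

lemma frobPow_zero_max {n p : ℕ} : frobPow (p ^ 0) (maxIdl n k) = maxIdl n k := by
  simp [frobPow]

lemma mem_maxIdl {n : ℕ} (f : MvPolynomial (Fin (n + 1)) k) :
    f ∈ maxIdl n k ↔ constantCoeff f = 0 := by
  rw [maxIdl, ← Set.image_univ, mem_ideal_span_X_image, constantCoeff_eq]
  constructor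
  · intro h
    by_contra h0
    obtain ⟨i, _, hi⟩ := h 0 (mem_support_iff.mpr h0)
    simp at hi
  · intro h m hm
    by_contra hcon
    push Not at hcon
    have : m = 0 := by ext i; simpa using hcon i (Set.mem_univ i)
    subst this
    exact mem_support_iff.mp hm h

lemma maxIdl_isMaximal (n : ℕ) : (maxIdl n k).IsMaximal := by
  have : maxIdl n k = RingHom.ker (constantCoeff (σ := Fin (n + 1)) (R := k)) := by
    ext f; rw [mem_maxIdl, RingHom.mem_ker]
  rw [this]
  exact RingHom.ker_isMaximal_of_surjective _ (fun a => ⟨C a, by simp⟩)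

lemma frobPow_le_self {R : Type*} [CommRing R] (q : ℕ) (hq : 0 < q) (I : Ideal R) :
    frobPow q I ≤ I := by
  rw [frobPow, Ideal.span_le]
  rintro _ ⟨x, hx, rfl⟩
  exact Ideal.pow_mem_of_mem _ hx _ hq

lemma frobPow_mono {R : Type*} [CommRing R] (q : ℕ) {I J : Ideal R} (h : I ≤ J) :
    frobPow q I ≤ frobPow q J :=
  Ideal.span_mono (Set.image_mono h)

lemma max_le_radical {n : ℕ} (q : ℕ) : maxIdl n k ≤ (frobPow q (maxIdl n k)).radical :=
  fun x hx => ⟨q, Ideal.subset_span ⟨x, hx, rfl⟩⟩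

lemma radical_frobPow {n : ℕ} (q : ℕ) (hq : 0 < q) :
    (frobPow q (maxIdl n k)).radical = maxIdl n k := by
  apply le_antisymm _ (max_le_radical q)
  have := (maxIdl_isMaximal (k := k) n).isPrime.radical
  exact (Ideal.radical_mono (frobPow_le_self q hq _)).trans this.le

lemma mem_max_of_mul {n : ℕ} (q : ℕ) (hq : 0 < q) (f y : MvPolynomial (Fin (n + 1)) k)
    (hf : f ∉ frobPow q (maxIdl n k)) (h : f * y ∈ frobPow q (maxIdl n k)) : y ∈ maxIdl n k := by
  have hp : (frobPow q (maxIdl n k)).IsPrimary := by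
    apply Ideal.isPrimary_of_isMaximal_radical
    rw [radical_frobPow q hq]
    exact maxIdl_isMaximal n
  rw [Ideal.isPrimary_iff] at hp
  have := (hp.2 h).resolve_left hf
  rwa [radical_frobPow q hq] at this

lemma mul_notMem {n p : ℕ} [Fact p.Prime] [CharP k p] (e e' : ℕ)
    (f g : MvPolynomial (Fin (n + 1)) k) (hf : f ∉ frobPow (p ^ e') (maxIdl n k))
    (hg : g ∉ frobPow (p ^ e) (maxIdl n k)) :
    f ^ p ^ e * g ∉ frobPow (p ^ (e' + e)) (maxIdl n k) := by
  intro h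
  exact hg (colonLemma e e' f g h (maxIdl n k) fun y hy =>
    mem_max_of_mul _ (pow_pos (Fact.out : p.Prime).pos _) f y hf hy)

lemma nu_ge {n q : ℕ} (I : Ideal (MvPolynomial (Fin (n + 1)) k)) (hI : I ≤ maxIdl n k) (r : ℕ)
    (hr : ¬ I ^ r ≤ frobPow q (maxIdl n k)) : r ≤ nuFn I q := by
  apply le_csSup _ hr
  have hfg : (maxIdl n k).FG := IsNoetherian.noetherian _
  obtain ⟨N, hN⟩ := Ideal.exists_pow_le_of_le_radical_of_fg (max_le_radical (k := k) (n := n) q) hfg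
  refine ⟨N, fun s hs => ?_⟩
  by_contra hcon
  exact hs (((Ideal.pow_le_pow_right (not_le.mp hcon).le).trans (Ideal.pow_right_mono hI N)).trans hN)

lemma exists_notMem_frobPow {n p : ℕ} [Fact p.Prime] [CharP k p]
    (g : MvPolynomial (Fin (n + 1)) k) (hg : g ≠ 0) :
    ∃ e, g ∉ frobPow (p ^ e) (maxIdl n k) := by
  obtain ⟨a, ha⟩ := support_nonempty.mpr hg
  refine ⟨a.degree, fun h => ?_⟩
  obtain ⟨i, hi⟩ := (mem_frobPow_max _ _).mp h a ha
  have h1 := Finsupp.le_degree i a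
  have h2 := Nat.lt_pow_self (n := a.degree) (Fact.out : p.Prime).one_lt
  omega

lemma pow_ceil_le {n p : ℕ} [Fact p.Prime] [CharP k p]
    (I : Ideal (MvPolynomial (Fin (n + 1)) k)) (hI : I ≤ maxIdl n k) (hI0 : I ≠ ⊥) (c : ℝ)
    (hfpt : Tendsto (fun e : ℕ => (nuFn I (p ^ e) : ℝ) / (p : ℝ) ^ e) atTop (nhds c)) (e : ℕ) :
    I ^ ⌈c * (p : ℝ) ^ e⌉₊ ≤ frobPow (p ^ e) (maxIdl n k) := by
  by_contra hcon
  set r := ⌈c * (p : ℝ) ^ e⌉₊ with hr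
  obtain ⟨f, hfI, hf⟩ := SetLike.not_le_iff_exists.mp hcon
  obtain ⟨g, hgI, hg0⟩ := Submodule.exists_mem_ne_zero_of_ne_bot hI0
  obtain ⟨e', hg⟩ := exists_notMem_frobPow (p := p) g hg0
  have hpp : (0 : ℝ) < p := by exact_mod_cast (Fact.out : p.Prime).pos
  have hF := mul_notMem e' e f g hf hg
  have hFI : f ^ p ^ e' * g ∈ I ^ (r * p ^ e' + 1) := by
    rw [pow_succ, pow_mul]
    exact Ideal.mul_mem_mul (Ideal.pow_mem_pow hfI _) hgI
  have hge : ∀ E, ((r * p ^ e' + 1 : ℕ) : ℝ) / (p : ℝ) ^ (e + e') ≤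
      (nuFn I (p ^ (E + (e + e'))) : ℝ) / (p : ℝ) ^ (E + (e + e')) := by
    intro E
    have h1 : (1 : MvPolynomial (Fin (n + 1)) k) ∉ frobPow (p ^ E) (maxIdl n k) := by
      intro h
      have := frobPow_le_self _ (pow_pos (Fact.out : p.Prime).pos _) _ h
      rw [mem_maxIdl] at this
      simp at this
    have h2 := mul_notMem E (e + e') _ 1 hF h1
    rw [mul_one] at h2
    have h3 : (r * p ^ e' + 1) * p ^ E ≤ nuFn I (p ^ ((e + e') + E)) := by
      apply nu_ge I hI
      intro hle
      apply h2
      apply hle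
      rw [pow_mul]
      exact Ideal.pow_mem_pow hFI _
    rw [add_comm E, div_le_div_iff₀ (by positivity) (by positivity), pow_add _ (e + e') E,
      mul_comm ((p : ℝ) ^ (e + e')) ((p : ℝ) ^ E), ← mul_assoc]
    apply mul_le_mul_of_nonneg_right _ (by positivity)
    exact_mod_cast h3
  have hlim := ge_of_tendsto ((tendsto_add_atTop_iff_nat (e + e')).mpr hfpt)
    (Eventually.of_forall hge)
  rw [div_le_iff₀ (by positivity)] at hlim
  have h4 : c * (p : ℝ) ^ e ≤ r := Nat.le_ceil _
  have h5 : c * (p : ℝ) ^ (e + e') ≤ r * (p : ℝ) ^ e' := by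
    rw [pow_add, ← mul_assoc]
    exact mul_le_mul_of_nonneg_right h4 (by positivity)
  push_cast at hlim
  linarith

lemma test_mul_le {n p : ℕ} [Fact p.Prime] [CharP k p]
    (I : Ideal (MvPolynomial (Fin (n + 1)) k)) (c : ℝ)
    (H : ∀ e : ℕ, I ^ ⌈c * (p : ℝ) ^ e⌉₊ ≤ frobPow (p ^ e) (maxIdl n k)) (e : ℕ)
    (a : MvPolynomial (Fin (n + 1)) k) (ha : a ∈ I ^ ⌈c * ((p : ℝ) ^ e - 1)⌉₊)
    (t : MvPolynomial (Fin (n + 1)) k) (ht : t ∈ testIdeal p c I) :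
    a * t ∈ frobPow (p ^ e) (maxIdl n k) := by
  let K : Ideal (MvPolynomial (Fin (n + 1)) k) :=
    Submodule.comap (LinearMap.mulLeft (MvPolynomial (Fin (n + 1)) k) a) (frobPow (p ^ e) (maxIdl n k))
  suffices testIdeal p c I ≤ K from this ht
  apply iSup_le
  intro e'
  apply sInf_le
  intro b hb
  apply colonLemma e' e a b _ K fun y hy => hy
  apply H
  have h1 : a ^ p ^ e' * b ∈ I ^ (⌈c * ((p : ℝ) ^ e - 1)⌉₊ * p ^ e' + ⌈c * (p : ℝ) ^ e'⌉₊) := by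
    rw [pow_add, pow_mul]
    exact Ideal.mul_mem_mul (Ideal.pow_mem_pow ha _) hb
  refine Ideal.pow_le_pow_right ?_ h1
  rw [Nat.ceil_le]
  push_cast
  have h2 := Nat.le_ceil (c * ((p : ℝ) ^ e - 1))
  have h3 := Nat.le_ceil (c * (p : ℝ) ^ e')
  have h4 := mul_le_mul_of_nonneg_right h2 (show (0 : ℝ) ≤ (p : ℝ) ^ e' by positivity)
  calc c * (p : ℝ) ^ (e + e') = c * ((p : ℝ) ^ e - 1) * p ^ e' + c * (p : ℝ) ^ e' := by
        rw [pow_add]; ring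
    _ ≤ _ := add_le_add h4 h3

open scoped Pointwise in
lemma exists_gens_pow {n : ℕ} (S : Set (MvPolynomial (Fin (n + 1)) k)) (d : ℕ)
    (hhom : ∀ f ∈ S, f.IsHomogeneous d) (N : ℕ) :
    ∃ P : Set (MvPolynomial (Fin (n + 1)) k), Ideal.span S ^ N = Ideal.span P ∧
      ∀ f ∈ P, f.IsHomogeneous (d * N) := by
  refine ⟨S ^ N, Submodule.span_pow S N, ?_⟩
  induction N with
  | zero =>
    intro f hf
    rw [pow_zero, Set.mem_one] at hf
    subst hf
    exact isHomogeneous_one _ _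
  | succ N ih =>
    intro f hf
    rw [pow_succ] at hf
    obtain ⟨f1, h1, f2, h2, rfl⟩ := hf
    exact (ih f1 h1).mul (hhom f2 h2)

/-- Theorem B: if `(R, I^c)` is sharply `F`-pure at `c = fpt(I)`, then
`c ≥ h/d` where `h` is the height of the test ideal `τ(R, I^c)`. -/
theorem stmt18 {n d h : ℕ} {p : ℕ} (hp : p.Prime) [CharP k p]
    (I : Ideal (MvPolynomial (Fin (n + 1)) k))
    (S : Set (MvPolynomial (Fin (n + 1)) k)) (hgen : I = Ideal.span S)
    (hhom : ∀ f ∈ S, f.IsHomogeneous d) (hd : 0 < d) (c : ℝ)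
    (hfpt : Tendsto (fun e : ℕ => (nuFn I (p ^ e) : ℝ) / (p : ℝ) ^ e) atTop (nhds c))
    (hSFP : SharplyFPurePair p I c)
    (hh : idealHeight (testIdeal p c I) = (h : ℕ∞)) :
    c ≥ (h : ℝ) / d := by
  classical
  have : Fact p.Prime := ⟨hp⟩
  have hc0 : 0 ≤ c := ge_of_tendsto hfpt (Eventually.of_forall fun e => by positivity)
  have hI : I ≤ maxIdl n k := by
    rw [hgen, Ideal.span_le]
    intro f hf
    rw [SetLike.mem_coe, mem_maxIdl, constantCoeff_eq]
    by_contra h0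
    have := hhom f hf h0
    simp at this
    omega
  have hne : testIdeal p c I ≠ ⊤ := by
    intro htop
    have : idealHeight (testIdeal p c I) = ⊤ := by
      rw [idealHeight, iInf_eq_top]
      intro P
      rw [iInf_eq_top]
      intro hP
      rw [htop, top_le_iff] at hP
      exact absurd hP P.2.ne_top
    rw [hh] at this
    exact ENat.natCast_ne_top h this
  have hI0 : I ≠ ⊥ := by
    intro hbot
    have hnu : ∀ e, nuFn I (p ^ e) = 0 := by
      intro e
      rw [nuFn, ← Nat.le_zero, ← Nat.bot_eq_zero]
      apply csSup_le'
      intro r hr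
      by_contra hr0
      apply hr
      have hr1 : r ≠ 0 := fun h => hr0 (by simp [h])
      rw [hbot, Submodule.bot_pow hr1]
      exact bot_le
    have hc : c = 0 := tendsto_nhds_unique hfpt (by simp [hnu])
    apply hne
    rw [eq_top_iff]
    refine le_trans ?_ (le_iSup _ 0)
    rw [hc]
    simp only [pow_zero, zero_mul, Nat.ceil_zero, frobRoot, frobPow]
    apply le_sInf
    intro K hK
    simpa using hK
  have H := pow_ceil_le I hI hI0 c hfpt
  obtain ⟨C0, hC0⟩ := combLemma (p := p) (testIdeal p c I) h (fun T hT =>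
    dimLemma T _ h (fun P hP hle => by
      have h1 : idealHeight (testIdeal p c I) ≤ Order.height (⟨P, hP⟩ : PrimeSpectrum _) :=
        iInf₂_le (⟨P, hP⟩ : PrimeSpectrum _) hle
      rw [hh] at h1
      exact h1.trans (PrimeSpectrum.height_eq_orderHeight (⟨P, hP⟩ : PrimeSpectrum _)).ge) hT)
  -- the key inequality for infinitely many `e`
  have key : ∃ᶠ e : ℕ in atTop,
      (h : ℝ) * ((p : ℝ) ^ e - 1) ≤ d * c * ((p : ℝ) ^ e - 1) + (d + C0) := by
    apply hSFP.mono
    rintro e ⟨-, he⟩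
    set N := ⌈c * ((p : ℝ) ^ e - 1)⌉₊ with hN
    have hnot : ¬ I ^ N ≤ frobPow (p ^ e) (maxIdl n k) := by
      intro hle
      apply (maxIdl_isMaximal (k := k) n).ne_top
      rw [eq_top_iff, ← he, Ideal.span_le]
      rintro _ ⟨φ, a, hφ, ha, rfl⟩
      have := phi_frobPow e 0 φ hφ a (by rw [zero_add]; exact hle ha)
      rwa [frobPow_zero_max] at this
    obtain ⟨f, hfI, hfhom, hf⟩ : ∃ f ∈ I ^ N, f.IsHomogeneous (d * N) ∧
        f ∉ frobPow (p ^ e) (maxIdl n k) := by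
      by_contra hcon
      push Not at hcon
      apply hnot
      obtain ⟨P, hP, hPhom⟩ := exists_gens_pow S d hhom N
      rw [← hgen] at hP
      rw [hP, Ideal.span_le]
      intro f hf
      exact hcon f (hP ▸ Ideal.subset_span hf) (hPhom f hf)
    rw [mem_frobPow_max] at hf
    push Not at hf
    obtain ⟨a, ha, hlt⟩ := hf
    let Q : Fin (n + 1) →₀ ℕ := Finsupp.equivFunOnFinite.symm (fun _ => p ^ e - 1)
    have hQ : ∀ i, Q i = p ^ e - 1 := fun i => rfl
    have haQ : a ≤ Q := fun i => by have := hlt i; rw [hQ]; omega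
    have hppos : 0 < p ^ e := pow_pos hp.pos e
    have hdega : a.degree = d * N := by
      have := hfhom (mem_support_iff.mp ha)
      rw [Finsupp.degree_eq_weight_one]; exact this
    have hdegQ : Q.degree = (n + 1) * (p ^ e - 1) := by
      rw [Finsupp.degree_eq_sum]; simp [hQ]
    have hdegg : (Q - a).degree + d * N = (n + 1) * (p ^ e - 1) := by
      rw [← hdega, ← hdegQ, ← map_add, tsub_add_cancel_of_le haQ]
    have hg : monomial (Q - a) (1 : k) ∉ testIdeal p c I ⊔ frobPow (p ^ e) (maxIdl n k) := by
      intro hmem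
      obtain ⟨t, ht, y, hy, hty⟩ := Submodule.mem_sup.mp hmem
      have h1 : f * monomial (Q - a) 1 ∈ frobPow (p ^ e) (maxIdl n k) := by
        rw [← hty, mul_add]
        exact Ideal.add_mem _ (test_mul_le I c H e f hfI t ht) (Ideal.mul_mem_left _ _ hy)
      obtain ⟨i, hi⟩ := (mem_frobPow_max _ _).mp h1 Q (by
        have h2 := coeff_mul_monomial a (Q - a) (1 : k) f
        rw [add_tsub_cancel_of_le haQ, mul_one] at h2
        rw [mem_support_iff, h2]
        exact mem_support_iff.mp ha)
      rw [hQ] at hi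
      omega
    have hle : h * (p ^ e - 1) ≤ d * N + C0 := by
      by_contra hcon
      exact hg (hC0 e (Q - a) (by omega))
    have hle' : (h : ℝ) * ((p : ℝ) ^ e - 1) ≤ d * N + C0 := by
      have : ((p ^ e - 1 : ℕ) : ℝ) = (p : ℝ) ^ e - 1 := by
        rw [Nat.cast_sub hppos]; simp
      rw [← this]
      exact_mod_cast hle
    have hge1 : (1 : ℝ) ≤ (p : ℝ) ^ e := by exact_mod_cast hppos
    have hNlt := Nat.ceil_lt_add_one (mul_nonneg hc0 (sub_nonneg.mpr hge1))
    have hdR : (0 : ℝ) ≤ d := by positivity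
    have := mul_le_mul_of_nonneg_left hNlt.le hdR
    rw [← hN] at this
    linarith
  have hdpos : (0 : ℝ) < d := by exact_mod_cast hd
  rw [ge_iff_le, div_le_iff₀ hdpos]
  by_contra hcon
  push Not at hcon
  have htend : Tendsto (fun e : ℕ => (h - c * d) * ((p : ℝ) ^ e - 1)) atTop atTop := by
    apply Tendsto.const_mul_atTop (sub_pos.mpr hcon)
    apply tendsto_atTop_add_const_right
    exact tendsto_pow_atTop_atTop_of_one_lt (by exact_mod_cast hp.one_lt)
  obtain ⟨e, h1, h2⟩ := (key.and_eventually (htend.eventually_gt_atTop ((d : ℝ) + C0))).exists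
  nlinarith
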